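/- arXiv:2003.04234 — 10 statements merged into one kernel-verified Lean document; each statement's English description precedes it below -/
import Mathlib

section
/- Let ℓ ≥ 2 be an integer, let c_1,…,c_{ℓ+1} ∈ {1,2,3} be colors, let μ be a nonzero complex number, and set C := ∏_{j=1}^{ℓ+1} s_{c_j}. Define the (ℓ+1)×(ℓ+1) complex matrix B̂ = (B_{i,j})_{i,j=0,…,ℓ} by: B_{j,j} = −(t₁t₂t₃/(t_{c_j} t_{c_{j+1}}))(s_{c_j} s_{c_{j+1}} − s_{c_j}⁻¹ s_{c_{j+1}}⁻¹) for 1 ≤ j ≤ ℓ; B_{0,0} = −(t₁t₂t₃/(t_{c_{ℓ+1}} t_{c_1}))(s_{c_{ℓ+1}} s_{c_1} − s_{c_{ℓ+1}}⁻¹ s_{c_1}⁻¹); B_{i−1,i} = B_{i,i−1} = t₁t₂t₃/t_{c_i} for 2 ≤ i ≤ ℓ; B_{0,ℓ} = B_{ℓ,0} = t₁t₂t₃/t_{c_{ℓ+1}}; B_{0,1} = (t₁t₂t₃/t_{c_1}) C μ⁻¹; B_{1,0} = (t₁t₂t₃/t_{c_1}) C⁻¹ μ; and all other entries 0. Then det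 B̂ = κ₁^{ℓ+1} (∏_{j=1}^{ℓ+1} t_{c_j}⁻¹) · (1−μ)(C⁻¹ − C μ⁻¹). -/
/-- The matrix with diagonal `a` and cyclic superdiagonal `b`. -/
def cyclicBidiagonal {R : Type*} [CommRing R] {n : ℕ} (a b : Fin (n + 1) → R) :
    Matrix (Fin (n + 1)) (Fin (n + 1)) R :=
  Matrix.of fun i j => (if i = j then a i else 0) + (if j = i + 1 then b i else 0)

theorem Fin.eq_add_one_iff_val {n : ℕ} (i j : Fin (n + 1)) :
    j = i + 1 ↔ i.val + 1 = j.val ∨ (i.val = n ∧ j.val = 0) := by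
  rw [Fin.ext_iff, Fin.val_add_one]
  split_ifs with h
  · subst h
    have := j.isLt
    simp only [Fin.val_last, true_and]
    omega
  · have : i.val ≠ n := fun h' => h (Fin.ext h')
    omega

theorem det_cyclicBidiagonal {R : Type*} [CommRing R] {n : ℕ} (a b : Fin (n + 1) → R) :
    (cyclicBidiagonal a b).det = ∏ i, a i + (-1) ^ n * ∏ i, b i := by
  have hupper : ((cyclicBidiagonal a b).submatrix Fin.castSucc Fin.castSucc).det =
      ∏ i : Fin n, a i.castSucc := by
    rw [Matrix.det_of_isUpperTriangular]
    · refine Finset.prod_congr rfl fun i _ => ?_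
      have h : ¬ i.castSucc = i.succ := by
        rw [Fin.ext_iff]
        simp
      simp [cyclicBidiagonal, h]
    · intro i j hij
      have hij' : j.val < i.val := hij
      have h : ¬ j.castSucc = i.succ := by
        rw [Fin.ext_iff]
        simp only [Fin.val_castSucc, Fin.val_succ]
        omega
      have h' : ¬ i = j := by rw [Fin.ext_iff]; omega
      simp [cyclicBidiagonal, h, h']
  have hlower : ((cyclicBidiagonal a b).submatrix Fin.castSucc Fin.succ).det =
      ∏ i : Fin n, b i.castSucc := by
    rw [Matrix.det_of_isLowerTriangular]
    · refine Finset.prod_congr rfl fun i _ => ?_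
      have h : ¬ i.castSucc = i.succ := by
        rw [Fin.ext_iff]
        simp
      simp [cyclicBidiagonal, h]
    · intro i j hij
      have hij' : i.val < j.val := hij
      have h : ¬ j = i := by rw [Fin.ext_iff]; omega
      have h' : ¬ i.castSucc = j.succ := by
        rw [Fin.ext_iff]
        simp only [Fin.val_castSucc, Fin.val_succ]
        omega
      simp [cyclicBidiagonal, h, h']
  have hrow (j : Fin (n + 1)) : cyclicBidiagonal a b (Fin.last n) j =
      (if Fin.last n = j then a (Fin.last n) else 0) +
        (if j = 0 then b (Fin.last n) else 0) := by
    simp [cyclicBidiagonal]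
  rw [Matrix.det_succ_row _ (Fin.last n), Fin.prod_univ_castSucc a, Fin.prod_univ_castSucc b]
  simp only [hrow, mul_add, add_mul, Finset.sum_add_distrib, mul_ite, ite_mul, mul_zero,
    zero_mul, Finset.sum_ite_eq, Finset.sum_ite_eq', Finset.mem_univ, if_true,
    Fin.succAbove_last, Fin.succAbove_zero, hupper, hlower, Fin.val_last, Fin.val_zero, add_zero,
    ← two_mul, pow_mul, neg_one_sq, one_pow]
  ring

theorem cyclicBidiagonal_transpose_mul_diagonal_mul {R : Type*} [CommRing R] {n : ℕ}
    (a b d a' b' : Fin (n + 1) → R) (i j : Fin (n + 1)) :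
    ((cyclicBidiagonal a b).transpose * Matrix.diagonal d * cyclicBidiagonal a' b') i j =
      (if i = j then a i * d i * a' i + b (i - 1) * d (i - 1) * b' (i - 1) else 0) +
        (if j = i + 1 then a i * d i * b' i else 0) +
        (if i = j + 1 then b j * d j * a' j else 0) := by
  have hshift (k l : Fin (n + 1)) : (k = l + 1) = (k - 1 = l) := by
    rw [sub_eq_iff_eq_add]
  have hsub : (i - 1 = j - 1) = (i = j) := by rw [sub_left_inj]
  rw [Matrix.mul_apply]
  simp_rw [Matrix.mul_diagonal]
  simp only [Matrix.transpose_apply, cyclicBidiagonal, Matrix.of_apply, mul_add, add_mul,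
    Finset.sum_add_distrib, mul_ite, ite_mul, mul_zero, zero_mul, hshift, Finset.sum_ite_eq,
    Finset.sum_ite_eq', Finset.mem_univ, if_true]
  grind

/-- determinant of the deformed affine Cartan matrix of type A. -/
theorem deformed_affine_cartan_det_typeA
    (q s t : Fin 3 → ℂ)
    (hq0 : ∀ i, q i ≠ 0) (hs0 : ∀ i, s i ≠ 0)
    (hsq : ∀ i, (s i) ^ 2 = q i)
    (hqprod : q 0 * q 1 * q 2 = 1)
    (hsprod : s 0 * s 1 * s 2 = 1)
    (hs1 : ∀ i, (s i) ^ 2 ≠ 1)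
    (ht : ∀ i, t i = s i - (s i)⁻¹)
    (κ : ℂ) (hκ : κ = (1 - q 0) * (1 - q 1) * (1 - q 2))
    (ℓ : ℕ) (hℓ : 2 ≤ ℓ)
    (c : Fin (ℓ + 1) → Fin 3)
    (μ : ℂ) (hμ : μ ≠ 0)
    (Cv : ℂ) (hCv : Cv = ∏ j : Fin (ℓ + 1), s (c j))
    (B : Matrix (Fin (ℓ + 1)) (Fin (ℓ + 1)) ℂ)
    (hB : ∀ i j : Fin (ℓ + 1), B i j =
      if i = j then
        (if i.val = 0 then
          -((t 0 * t 1 * t 2) / (t (c (Fin.last ℓ)) * t (c 0))) *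
            (s (c (Fin.last ℓ)) * s (c 0) - (s (c (Fin.last ℓ)))⁻¹ * (s (c 0))⁻¹)
         else
          -((t 0 * t 1 * t 2) / (t (c (i - 1)) * t (c i))) *
            (s (c (i - 1)) * s (c i) - (s (c (i - 1)))⁻¹ * (s (c i))⁻¹))
      else if i.val + 1 = j.val then
        (if i.val = 0 then (t 0 * t 1 * t 2) / t (c 0) * Cv * μ⁻¹
         else (t 0 * t 1 * t 2) / t (c i))
      else if j.val + 1 = i.val then
        (if j.val = 0 then (t 0 * t 1 * t 2) / t (c 0) * Cv⁻¹ * μ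
         else (t 0 * t 1 * t 2) / t (c j))
      else if (i.val = 0 ∧ j.val = ℓ) ∨ (i.val = ℓ ∧ j.val = 0) then
        (t 0 * t 1 * t 2) / t (c (Fin.last ℓ))
      else 0) :
    B.det = κ ^ (ℓ + 1) * (∏ j : Fin (ℓ + 1), (t (c j))⁻¹) *
      ((1 - μ) * (Cv⁻¹ - Cv * μ⁻¹)) := by
  have ht0 (i) : t i ≠ 0 := by
    intro h
    rw [ht, sub_eq_zero] at h
    apply hs1 i
    rw [sq]
    nth_rewrite 2 [h]
    exact mul_inv_cancel₀ (hs0 i)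
  have hC0 : Cv ≠ 0 := by
    rw [hCv]
    exact Finset.prod_ne_zero_iff.mpr fun i _ => hs0 _
  have hκt : κ = -(t 0 * t 1 * t 2) := by
    have h (i) : 1 - q i = -(s i * t i) := by
      rw [ht, ← hsq, mul_sub, mul_inv_cancel₀ (hs0 i)]
      ring
    rw [hκ, h, h, h]
    linear_combination (-(t 0 * t 1 * t 2)) * hsprod
  have hdiag (x y : Fin 3) : -(t 0 * t 1 * t 2 / (t x * t y)) * (s x * s y - (s x)⁻¹ * (s y)⁻¹) =
      s y * (κ * (t y)⁻¹) + κ * (t x)⁻¹ * (s x)⁻¹ := by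
    have h : s x * s y - (s x)⁻¹ * (s y)⁻¹ = t x * s y + (s x)⁻¹ * t y := by
      rw [ht x, ht y]
      ring
    rw [h, hκt]
    have := ht0 x
    have := ht0 y
    field_simp
    ring
  have hfact : B = (cyclicBidiagonal (fun i => s (c i))
        (fun i => -(if i = 0 then Cv⁻¹ * μ else 1))).transpose *
      Matrix.diagonal (fun i => κ * (t (c i))⁻¹) *
      cyclicBidiagonal (fun _ => 1)
        (fun i => -((if i = 0 then Cv * μ⁻¹ else 1) * (s (c i))⁻¹)) := by
    have hcorner : Cv⁻¹ * μ * (Cv * μ⁻¹) = 1 := by field_simp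
    have hgauge (i : Fin (ℓ + 1)) : (if i = 0 then Cv⁻¹ * μ else 1) *
        (if i = 0 then Cv * μ⁻¹ else 1) = 1 := by
      split_ifs
      · exact hcorner
      · exact one_mul 1
    have hsuper (i : Fin (ℓ + 1)) (x : ℂ) :
        s (c i) * (κ * (t (c i))⁻¹) * -(x * (s (c i))⁻¹) = t 0 * t 1 * t 2 / t (c i) * x := by
      have := ht0 (c i)
      have := hs0 (c i)
      rw [hκt]
      field_simp
    have hsub (i : Fin (ℓ + 1)) (x : ℂ) :
        -x * (κ * (t (c i))⁻¹) * 1 = t 0 * t 1 * t 2 / t (c i) * x := by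
      rw [hκt]
      ring
    ext i j
    rw [cyclicBidiagonal_transpose_mul_diagonal_mul, hB]
    simp only [hsuper, hsub, Fin.eq_add_one_iff_val]
    have hi := i.isLt
    have hj := j.isLt
    by_cases hij : i = j
    · subst hij
      have hn : ¬(i.val + 1 = i.val ∨ (i.val = ℓ ∧ i.val = 0)) := by omega
      simp only [if_pos, if_neg hn, add_zero]
      have hB' : -(t 0 * t 1 * t 2 / (t (c (i - 1)) * t (c i))) *
          (s (c (i - 1)) * s (c i) - (s (c (i - 1)))⁻¹ * (s (c i))⁻¹) =
          s (c i) * (κ * (t (c i))⁻¹) * 1 +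
          -(if i - 1 = 0 then Cv⁻¹ * μ else 1) * (κ * (t (c (i - 1)))⁻¹) *
            -((if i - 1 = 0 then Cv * μ⁻¹ else 1) * (s (c (i - 1)))⁻¹) := by
        rw [hdiag]
        linear_combination (-(κ * (t (c (i - 1)))⁻¹ * (s (c (i - 1)))⁻¹)) * hgauge (i - 1)
      rw [← hB']
      split_ifs with h
      · obtain rfl : i = 0 := Fin.ext h
        rw [show (0 : Fin (ℓ + 1)) - 1 = Fin.last ℓ by
          rw [sub_eq_iff_eq_add, Fin.last_add_one]]
      · rfl
    · have hij' : i.val ≠ j.val := fun h => hij (Fin.ext h)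
      simp only [if_neg hij, zero_add]
      by_cases h1 : i.val + 1 = j.val
      · have hn : ¬(j.val + 1 = i.val ∨ (j.val = ℓ ∧ i.val = 0)) := by omega
        rw [if_pos h1, if_pos (Or.inl h1), if_neg hn, add_zero]
        by_cases h0 : i.val = 0
        · obtain rfl : i = 0 := Fin.ext h0
          simp [mul_assoc]
        · rw [if_neg h0, if_neg (fun h => h0 (congrArg Fin.val h)), mul_one]
      have hn : i.val + 1 = j.val ∨ (i.val = ℓ ∧ j.val = 0) ↔ i.val = ℓ ∧ j.val = 0 := by omega
      rw [if_neg h1]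
      simp only [hn]
      clear hn
      by_cases h2 : j.val + 1 = i.val
      · have hn : ¬(i.val = ℓ ∧ j.val = 0) := by omega
        rw [if_pos h2, if_neg hn, if_pos (Or.inl h2), zero_add]
        by_cases h0 : j.val = 0
        · obtain rfl : j = 0 := Fin.ext h0
          simp [mul_assoc]
        · rw [if_neg h0, if_neg (fun h => h0 (congrArg Fin.val h)), mul_one]
      have hn : j.val + 1 = i.val ∨ (j.val = ℓ ∧ i.val = 0) ↔ j.val = ℓ ∧ i.val = 0 := by omega
      rw [if_neg h2]
      simp only [hn]
      clear hn
      have hlast : Fin.last ℓ ≠ 0 := fun h => by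
        have := congrArg Fin.val h
        simp only [Fin.val_last, Fin.val_zero] at this
        omega
      by_cases h3 : i.val = ℓ ∧ j.val = 0
      · have h4 : ¬(j.val = ℓ ∧ i.val = 0) := by omega
        rw [if_pos (Or.inr h3), if_pos h3, if_neg h4]
        obtain rfl : i = Fin.last ℓ := Fin.ext h3.1
        rw [if_neg hlast, mul_one, add_zero]
      by_cases h4 : j.val = ℓ ∧ i.val = 0
      · rw [if_pos (Or.inl h4.symm), if_neg h3, if_pos h4]
        obtain rfl : j = Fin.last ℓ := Fin.ext h4.1
        rw [if_neg hlast, mul_one, zero_add]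
      rw [if_neg (not_or.mpr ⟨fun h => h4 h.symm, h3⟩), if_neg h3, if_neg h4, add_zero]
  have hprod (x : ℂ) : ∏ i : Fin (ℓ + 1), (if i = 0 then x else 1) = x := by
    rw [Finset.prod_ite_eq' Finset.univ 0 (fun _ => x), if_pos (Finset.mem_univ _)]
  have hsign (x : ℂ) : (-1) ^ ℓ * ((-1) ^ (ℓ + 1) * x) = -x := by
    rw [← mul_assoc, ← pow_add, Odd.neg_one_pow ⟨ℓ, by ring⟩, neg_one_mul]
  rw [hfact, Matrix.det_mul, Matrix.det_mul, Matrix.det_transpose, Matrix.det_diagonal,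
    det_cyclicBidiagonal, det_cyclicBidiagonal]
  simp only [Finset.prod_neg, Finset.card_univ, Fintype.card_fin, Finset.prod_mul_distrib,
    Finset.prod_inv_distrib, Finset.prod_const, one_pow, hprod, hsign, ← hCv]
  field_simp
  ring
end

section
/- Let ℓ ≥ 2 be an integer, let c_1,…,c_{ℓ+1} ∈ {1,2,3} be colors, set C := ∏_{j=1}^{ℓ+1} s_{c_j}, and let B̂ = (B_{i,j})_{i,j=0,…,ℓ} be the matrix of the deformed affine Cartan form specialized at μ = 1, i.e.: B_{j,j} = −(t₁t₂t₃/(t_{c_j} t_{c_{j+1}}))(s_{c_j} s_{c_{j+1}} − s_{c_j}⁻¹ s_{c_{j+1}}⁻¹) for 1 ≤ j ≤ ℓ; B_{0,0} = −(t₁t₂t₃/(t_{c_{ℓ+1}} t_{c_1}))(s_{c_{ℓ+1}} s_{c_1} − s_{c_{ℓ+1}}⁻¹ s_{c_1}⁻¹); B_{i−1,i} = B_{i,i−1} = t₁t₂t₃/t_{c_i} for 2 ≤ i ≤ ℓ; B_{0,ℓ} = B_{ℓ,0} = t₁t₂t₃/t_{c_{ℓ+1}}; B_{0,1} = (t₁t₂t₃/t_{c_1})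 C; B_{1,0} = (t₁t₂t₃/t_{c_1}) C⁻¹; all other entries 0. Define the vector y = (y_0, y_1, …, y_ℓ) by y_0 = C and y_i = s_{c_1} s_{c_2} ⋯ s_{c_i} for 1 ≤ i ≤ ℓ. Then B̂ · y = 0, i.e., y lies in the kernel of B̂. -/
/-- Extending a partial product over `Fin n` by one factor. -/
lemma Fin.prod_ite_val_lt_succ {M : Type*} [CommMonoid M] {n : ℕ} (f : Fin n → M) (k : Fin n) :
    (∏ j : Fin n, if j.val < k.val + 1 then f j else 1) =
      (∏ j : Fin n, if j.val < k.val then f j else 1) * f k := by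
  have h : f k = ∏ j : Fin n, if j = k then f j else 1 := by simp
  rw [h, ← Finset.prod_mul_distrib]
  refine Finset.prod_congr rfl fun j _ => ?_
  rcases lt_trichotomy j k with hjk | rfl | hjk
  · have : j.val < k.val := hjk
    simp [this, hjk.ne, Nat.lt_succ_of_lt this]
  · simp
  · have : k.val < j.val := hjk
    have h1 : ¬ j.val < k.val + 1 := by omega
    have h2 : ¬ j.val < k.val := by omega
    simp [h1, h2, hjk.ne']

/-- A finite sum supported on three distinct indices. -/
lemma Fintype.sum_eq_add_add {ι M : Type*} [Fintype ι] [AddCommMonoid M] {f : ι → M} {a b d : ι}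
    (hab : a ≠ b) (had : a ≠ d) (hbd : b ≠ d)
    (h : ∀ x, x ≠ a → x ≠ b → x ≠ d → f x = 0) : ∑ x, f x = f a + f b + f d := by
  classical
  rw [← Finset.sum_subset (Finset.subset_univ {a, b, d})]
  · rw [Finset.sum_insert (by simp [hab, had]), Finset.sum_pair hbd, add_assoc]
  · intro x _ hx
    simp only [Finset.mem_insert, Finset.mem_singleton, not_or] at hx
    exact h x hx.1 hx.2.1 hx.2.2

/-- The three-term relation satisfied by consecutive entries `p`, `p * a`, `p * a * b` of the
kernel vector. -/
lemma deformed_cartan_three_term {K : Type*} [Field K] {a b u v : K} (T p : K) (ha : a ≠ 0)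
    (hb : b ≠ 0) (hu0 : u ≠ 0) (hv0 : v ≠ 0) (hu : u = a - a⁻¹) (hv : v = b - b⁻¹) :
    T / u * p + -(T / (u * v)) * (a * b - a⁻¹ * b⁻¹) * (p * a) + T / v * (p * a * b) = 0 := by
  have key : v - (a * b - a⁻¹ * b⁻¹) * a + u * (a * b) = 0 := by
    rw [hu, hv]
    field_simp
    ring
  have : T / u * p + -(T / (u * v)) * (a * b - a⁻¹ * b⁻¹) * (p * a) + T / v * (p * a * b) =
      T * p / (u * v) * (v - (a * b - a⁻¹ * b⁻¹) * a + u * (a * b)) := by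
    generalize a * b - a⁻¹ * b⁻¹ = w
    field_simp
    ring
  rw [this, key, mul_zero]


/-- the explicit vector `y` lies in the kernel of the deformed
affine Cartan matrix of type A specialized at `μ = 1`. -/
theorem deformed_affine_cartan_kernel_vector_typeA
    (q s t : Fin 3 → ℂ)
    (hq0 : ∀ i, q i ≠ 0) (hs0 : ∀ i, s i ≠ 0)
    (hsq : ∀ i, (s i) ^ 2 = q i)
    (hqprod : q 0 * q 1 * q 2 = 1)
    (hsprod : s 0 * s 1 * s 2 = 1)
    (hs1 : ∀ i, (s i) ^ 2 ≠ 1)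
    (ht : ∀ i, t i = s i - (s i)⁻¹)
    (ℓ : ℕ) (hℓ : 2 ≤ ℓ)
    (c : Fin (ℓ + 1) → Fin 3)
    (Cv : ℂ) (hCv : Cv = ∏ j : Fin (ℓ + 1), s (c j))
    (B : Matrix (Fin (ℓ + 1)) (Fin (ℓ + 1)) ℂ)
    (hB : ∀ i j : Fin (ℓ + 1), B i j =
      if i = j then
        (if i.val = 0 then
          -((t 0 * t 1 * t 2) / (t (c (Fin.last ℓ)) * t (c 0))) *
            (s (c (Fin.last ℓ)) * s (c 0) - (s (c (Fin.last ℓ)))⁻¹ * (s (c 0))⁻¹)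
         else
          -((t 0 * t 1 * t 2) / (t (c (i - 1)) * t (c i))) *
            (s (c (i - 1)) * s (c i) - (s (c (i - 1)))⁻¹ * (s (c i))⁻¹))
      else if i.val + 1 = j.val then
        (if i.val = 0 then (t 0 * t 1 * t 2) / t (c 0) * Cv
         else (t 0 * t 1 * t 2) / t (c i))
      else if j.val + 1 = i.val then
        (if j.val = 0 then (t 0 * t 1 * t 2) / t (c 0) * Cv⁻¹
         else (t 0 * t 1 * t 2) / t (c j))
      else if (i.val = 0 ∧ j.val = ℓ) ∨ (i.val = ℓ ∧ j.val = 0) then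
        (t 0 * t 1 * t 2) / t (c (Fin.last ℓ))
      else 0)
    (y : Fin (ℓ + 1) → ℂ)
    (hy : ∀ i : Fin (ℓ + 1), y i =
      if i.val = 0 then Cv
      else ∏ j : Fin (ℓ + 1), if j.val < i.val then s (c j) else 1) :
    B.mulVec y = 0 := by
  have ht0 : ∀ i, t i ≠ 0 := by
    intro i h
    rw [ht, sub_eq_zero] at h
    apply hs1 i
    rw [pow_two]
    nth_rewrite 2 [h]
    exact mul_inv_cancel₀ (hs0 i)
  have hC0 : Cv ≠ 0 := by
    rw [hCv]
    exact Finset.prod_ne_zero_iff.mpr fun j _ => hs0 _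
  obtain ⟨P, hP⟩ : ∃ P : ℕ → ℂ, ∀ n, P n = ∏ j : Fin (ℓ + 1), if j.val < n then s (c j) else 1 :=
    ⟨_, fun _ => rfl⟩
  have hP0 : P 0 = 1 := by simp [hP]
  have hPlast : P (ℓ + 1) = Cv := by
    rw [hP, hCv]
    exact Finset.prod_congr rfl fun j _ => if_pos j.isLt
  have hPs : ∀ k : Fin (ℓ + 1), P (k.val + 1) = P k.val * s (c k) := fun k => by
    rw [hP, hP, Fin.prod_ite_val_lt_succ fun j => s (c j)]
  have hy0 : y 0 = Cv := by simp [hy]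
  have hyP : ∀ i : Fin (ℓ + 1), i.val ≠ 0 → y i = P i.val := fun i hi => by
    rw [hy, if_neg hi, hP]
  ext i
  rw [Matrix.mulVec, dotProduct, Pi.zero_apply]
  obtain ⟨k, hk⟩ := i
  rcases k with _ | k
  · have h1 : 1 < ℓ + 1 := by omega
    rw [Fintype.sum_eq_add_add (a := Fin.last ℓ) (b := 0) (d := ⟨1, h1⟩)
      (by simp [Fin.ext_iff]; omega) (by simp [Fin.ext_iff]; omega) (by simp [Fin.ext_iff])]
    · have e1 : B ⟨0, hk⟩ (Fin.last ℓ) = t 0 * t 1 * t 2 / t (c (Fin.last ℓ)) := by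
        rw [hB, if_neg (by simp [Fin.ext_iff]; omega), if_neg (by simp; omega),
          if_neg (by simp), if_pos (by simp)]
      have e2 : B ⟨0, hk⟩ 0 = -((t 0 * t 1 * t 2) / (t (c (Fin.last ℓ)) * t (c 0))) *
            (s (c (Fin.last ℓ)) * s (c 0) - (s (c (Fin.last ℓ)))⁻¹ * (s (c 0))⁻¹) := by
        rw [hB, if_pos (by simp), if_pos (by simp)]
      have e3 : B ⟨0, hk⟩ ⟨1, h1⟩ = t 0 * t 1 * t 2 / t (c 0) * Cv := by
        rw [hB, if_neg (by simp), if_pos (by simp), if_pos (by simp)]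
      have y1 : y (Fin.last ℓ) = P ℓ := hyP _ (by simp; omega)
      have y2 : Cv = P ℓ * s (c (Fin.last ℓ)) := hPlast ▸ hPs (Fin.last ℓ)
      have y3 : y ⟨1, h1⟩ = s (c 0) := by
        have := hPs 0
        rw [Fin.val_zero, hP0, one_mul] at this
        rw [hyP _ (by simp)]
        exact this
      rw [e1, e2, e3, y1, hy0, y3, y2, mul_assoc (t 0 * t 1 * t 2 / t (c 0))]
      exact deformed_cartan_three_term _ _ (hs0 _) (hs0 _) (ht0 _) (ht0 _) (ht _) (ht _)
    · intro x hx1 hx2 hx3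
      simp only [ne_eq, Fin.ext_iff, Fin.val_last, Fin.val_zero] at hx1 hx2 hx3
      rw [hB, if_neg (by simp only [Fin.ext_iff]; omega), if_neg (by simp only; omega),
        if_neg (by simp only; omega), if_neg (by simp only; omega), zero_mul]
  · have hk' : k < ℓ + 1 := by omega
    have hpred : (⟨k + 1, hk⟩ : Fin (ℓ + 1)) - 1 = ⟨k, hk'⟩ := by
      rw [sub_eq_iff_eq_add, Fin.ext_iff, Fin.val_add_one_of_lt]
      simp only [Fin.lt_def, Fin.val_last]
      omega
    obtain ⟨d, hd⟩ : ∃ d : Fin (ℓ + 1),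
        (k + 1 = ℓ ∧ d.val = 0) ∨ (k + 1 < ℓ ∧ d.val = k + 2) := by
      by_cases h : k + 1 = ℓ
      · exact ⟨0, Or.inl ⟨h, rfl⟩⟩
      · exact ⟨⟨k + 2, by omega⟩, Or.inr ⟨by omega, rfl⟩⟩
    rw [Fintype.sum_eq_add_add (a := ⟨k, hk'⟩) (b := ⟨k + 1, hk⟩) (d := d)
      (by simp [Fin.ext_iff]) (by simp only [ne_eq, Fin.ext_iff]; omega)
      (by simp only [ne_eq, Fin.ext_iff]; omega)]
    · have e1 : B ⟨k + 1, hk⟩ ⟨k, hk'⟩ * y ⟨k, hk'⟩ = t 0 * t 1 * t 2 / t (c ⟨k, hk'⟩) * P k := by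
        rw [hB, if_neg (by simp [Fin.ext_iff]), if_neg (by simp only; omega), if_pos rfl]
        by_cases h : k = 0
        · subst h
          rw [if_pos rfl, hP0, mul_assoc, hy, if_pos rfl, inv_mul_cancel₀ hC0]
          rfl
        · rw [if_neg h, hyP _ h]
      have e2 : B ⟨k + 1, hk⟩ ⟨k + 1, hk⟩ =
          -((t 0 * t 1 * t 2) / (t (c ⟨k, hk'⟩) * t (c ⟨k + 1, hk⟩))) *
            (s (c ⟨k, hk'⟩) * s (c ⟨k + 1, hk⟩) -
              (s (c ⟨k, hk'⟩))⁻¹ * (s (c ⟨k + 1, hk⟩))⁻¹) := by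
        rw [hB, if_pos rfl, if_neg (by simp), hpred]
      have y1 : P (k + 1) = P k * s (c ⟨k, hk'⟩) := hPs ⟨k, hk'⟩
      have y2 : P (k + 2) = P (k + 1) * s (c ⟨k + 1, hk⟩) := hPs ⟨k + 1, hk⟩
      have e3 : B ⟨k + 1, hk⟩ d * y d = t 0 * t 1 * t 2 / t (c ⟨k + 1, hk⟩) * P (k + 2) := by
        rcases hd with ⟨h, hd⟩ | ⟨h, hd⟩
        · have hlast : Fin.last ℓ = ⟨k + 1, hk⟩ := Fin.ext h.symm
          rw [hB, if_neg (by simp only [Fin.ext_iff]; omega), if_neg (by simp only; omega),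
            if_neg (by simp only; omega), if_pos (by simp only; omega), hy, if_pos hd, hlast,
            ← hPlast, show P (ℓ + 1) = P (k + 2) by rw [← h]]
        · rw [hB, if_neg (by simp only [Fin.ext_iff]; omega), if_pos (by simp only; omega),
            if_neg (by simp), hyP _ (by omega), hd]
      rw [e1, e2, e3, hyP _ (by simp), y2, y1]
      exact deformed_cartan_three_term _ _ (hs0 _) (hs0 _) (ht0 _) (ht0 _) (ht _) (ht _)
    · intro x hx1 hx2 hx3
      simp only [ne_eq, Fin.ext_iff] at hx1 hx2 hx3
      have := x.isLt
      rw [hB, if_neg (by simp only [Fin.ext_iff]; omega), if_neg (by simp only; omega),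
        if_neg (by simp only; omega), if_neg (by simp only; omega), zero_mul]
end

section
/- For all nonzero complex numbers z1, z2, z3 the following polynomial identity holds: (z1/z2 − z2/z1)(g_{13} g_{23} − g_{31} g_{32}) + (z2/z3 − z3/z2) g_{31} (g_{23} + g_{32}) + (z1/z3 − z3/z1)(g_{13} + g_{31}) g_{23} = κ₁ (1 − z3²/(z1 z2)) (z1 + z3)(z2 + z3) z3 g_{12}. -/
/-- polynomial identity used in the proof of the comodule property. -/
theorem g_polynomial_identity
    (q1 q2 q3 : ℂ) (hq1 : q1 ≠ 0) (hq2 : q2 ≠ 0) (hq3 : q3 ≠ 0)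
    (hq : q1 * q2 * q3 = 1)
    (g : ℂ → ℂ → ℂ)
    (hg : ∀ z w, g z w = (z - q1 * w) * (z - q2 * w) * (z - q3 * w))
    (κ : ℂ) (hκ : κ = (1 - q1) * (1 - q2) * (1 - q3))
    (z1 z2 z3 : ℂ) (hz1 : z1 ≠ 0) (hz2 : z2 ≠ 0) (hz3 : z3 ≠ 0) :
    (z1 / z2 - z2 / z1) * (g z1 z3 * g z2 z3 - g z3 z1 * g z3 z2)
      + (z2 / z3 - z3 / z2) * g z3 z1 * (g z2 z3 + g z3 z2)
      + (z1 / z3 - z3 / z1) * (g z1 z3 + g z3 z1) * g z2 z3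
    = κ * (1 - z3 ^ 2 / (z1 * z2)) * (z1 + z3) * (z2 + z3) * z3 * g z1 z2 := by
  have g_eq : ∀ z w, g z w = z ^ 3 - (q1 + q2 + q3) * z ^ 2 * w
      + (q1 * q2 + q1 * q3 + q2 * q3) * z * w ^ 2 - w ^ 3 := fun z w ↦ by
    rw [hg]
    linear_combination -w ^ 3 * hq
  have κ_eq : κ = (q1 * q2 + q1 * q3 + q2 * q3) - (q1 + q2 + q3) := by
    rw [hκ]
    linear_combination -hq
  simp only [g_eq, κ_eq]
  generalize q1 + q2 + q3 = a
  generalize q1 * q2 + q1 * q3 + q2 * q3 = b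
  field_simp
  ring
end

section
/- For all nonzero complex numbers z1, z2, z3 with g(z3,z2) ≠ 0 and g(z2,z1) ≠ 0, the following identity of rational functions holds: ((z1 + z2)(z3² − z1 z2)/(z1 z2 z3)) · ḡ(z3,z2)/g(z3,z2) + ((z2 + z3)(z1² − z2 z3)/(z1 z2 z3)) · ḡ(z2,z1)/g(z2,z1) + (z3 + z1)(z2² − z3 z1)/(z1 z2 z3) = κ₁ · g(z1,z3) (z3 + z2)(z1 + z2)(z2² − z3 z1) z2 / (g(z3,z2) g(z2,z1) z3 z1). -/
/-- the rational-function form of `X(z1,z2,z3)`. -/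
theorem X_rational_function_identity
    (q1 q2 q3 : ℂ) (hq1 : q1 ≠ 0) (hq2 : q2 ≠ 0) (hq3 : q3 ≠ 0)
    (hq : q1 * q2 * q3 = 1)
    (g gb : ℂ → ℂ → ℂ)
    (hg : ∀ z w, g z w = (z - q1 * w) * (z - q2 * w) * (z - q3 * w))
    (hgb : ∀ z w, gb z w = (z - q1⁻¹ * w) * (z - q2⁻¹ * w) * (z - q3⁻¹ * w))
    (κ : ℂ) (hκ : κ = (1 - q1) * (1 - q2) * (1 - q3))
    (z1 z2 z3 : ℂ) (hz1 : z1 ≠ 0) (hz2 : z2 ≠ 0) (hz3 : z3 ≠ 0)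
    (h32 : g z3 z2 ≠ 0) (h21 : g z2 z1 ≠ 0) :
    ((z1 + z2) * (z3 ^ 2 - z1 * z2) / (z1 * z2 * z3)) * (gb z3 z2 / g z3 z2)
      + ((z2 + z3) * (z1 ^ 2 - z2 * z3) / (z1 * z2 * z3)) * (gb z2 z1 / g z2 z1)
      + (z3 + z1) * (z2 ^ 2 - z3 * z1) / (z1 * z2 * z3)
    = κ * g z1 z3 * (z3 + z2) * (z1 + z2) * (z2 ^ 2 - z3 * z1) * z2 /
        (g z3 z2 * g z2 z1 * z3 * z1) := by
  have hG (z w : ℂ) : g z w =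
      z ^ 3 - (q1 + q2 + q3) * z ^ 2 * w + (q1 * q2 + q2 * q3 + q3 * q1) * z * w ^ 2 - w ^ 3 := by
    rw [hg]
    linear_combination (-w ^ 3) * hq
  have hκ' : κ = (q1 * q2 + q2 * q3 + q3 * q1) - (q1 + q2 + q3) := by
    rw [hκ]
    linear_combination -hq
  have hi1 : q1⁻¹ = q2 * q3 := inv_eq_of_mul_eq_one_right (by rw [← hq]; ring)
  have hi2 : q2⁻¹ = q3 * q1 := inv_eq_of_mul_eq_one_right (by rw [← hq]; ring)
  have hi3 : q3⁻¹ = q1 * q2 := inv_eq_of_mul_eq_one_right (by rw [← hq]; ring)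
  have hGb (z w : ℂ) : gb z w =
      z ^ 3 - (q1 * q2 + q2 * q3 + q3 * q1) * z ^ 2 * w + (q1 + q2 + q3) * z * w ^ 2 - w ^ 3 := by
    rw [hgb, hi1, hi2, hi3]
    linear_combination
      ((q1 + q2 + q3) * z * w ^ 2 - (q1 * q2 * q3 + 1) * w ^ 3) * hq
  generalize q1 + q2 + q3 = a at *
  generalize q1 * q2 + q2 * q3 + q3 * q1 = b at *
  field_simp
  simp only [hG, hGb, hκ']
  ring
end

section
/- For all nonzero complex numbers z1, z2, z3 such that g_{31}, g_{21}, g_{32} are nonzero, the following identity of rational functions holds: −(z3/z2 − z2/z3 − z1/z3 + z3/z1) · g_{13} g_{12}/(g_{31} g_{21}) − (z1/z2 − z2/z1 − z3/z1 + z1/z3) · g_{13} g_{23}/(g_{31} g_{32}) + (z2/z1 − z1/z2 − z3/z2 + z2/z3) · g_{12} g_{13} g_{23}/(g_{21} g_{31} g_{32}) = κ₁ (z2²/(z1 z3) − 1) · z2 (z2 + z1)(z2 + z3) · g_{13}/(g_{21} g_{32}). -/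
/-- The Serre relation coefficient identity with the denominators `g z2 z1`, `g z3 z1`, `g z3 z2`
cleared, for an arbitrary cubic `z³ - a z² w + b z w² - w³`. -/
theorem serre_delta_numerator_identity (a b z1 z2 z3 : ℂ)
    (hz1 : z1 ≠ 0) (hz2 : z2 ≠ 0) (hz3 : z3 ≠ 0) :
    -((z3 / z2 - z2 / z3 - z1 / z3 + z3 / z1) *
        (z1 ^ 3 - a * z1 ^ 2 * z2 + b * z1 * z2 ^ 2 - z2 ^ 3) *
        (z3 ^ 3 - a * z3 ^ 2 * z2 + b * z3 * z2 ^ 2 - z2 ^ 3))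
      - (z1 / z2 - z2 / z1 - z3 / z1 + z1 / z3) *
        (z2 ^ 3 - a * z2 ^ 2 * z3 + b * z2 * z3 ^ 2 - z3 ^ 3) *
        (z2 ^ 3 - a * z2 ^ 2 * z1 + b * z2 * z1 ^ 2 - z1 ^ 3)
      + (z2 / z1 - z1 / z2 - z3 / z2 + z2 / z3) *
        (z1 ^ 3 - a * z1 ^ 2 * z2 + b * z1 * z2 ^ 2 - z2 ^ 3) *
        (z2 ^ 3 - a * z2 ^ 2 * z3 + b * z2 * z3 ^ 2 - z3 ^ 3)
    = (b - a) * (z2 ^ 2 / (z1 * z3) - 1) * z2 * (z2 + z1) * (z2 + z3) *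
        (z3 ^ 3 - a * z3 ^ 2 * z1 + b * z3 * z1 ^ 2 - z1 ^ 3) := by
  field_simp
  ring


/-- the coefficient of `δ(C² z1/z3)` in the Serre relation. -/
theorem serre_delta_coefficient_identity
    (q1 q2 q3 : ℂ) (hq1 : q1 ≠ 0) (hq2 : q2 ≠ 0) (hq3 : q3 ≠ 0)
    (hq : q1 * q2 * q3 = 1)
    (g : ℂ → ℂ → ℂ)
    (hg : ∀ z w, g z w = (z - q1 * w) * (z - q2 * w) * (z - q3 * w))
    (κ : ℂ) (hκ : κ = (1 - q1) * (1 - q2) * (1 - q3))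
    (z1 z2 z3 : ℂ) (hz1 : z1 ≠ 0) (hz2 : z2 ≠ 0) (hz3 : z3 ≠ 0)
    (h31 : g z3 z1 ≠ 0) (h21 : g z2 z1 ≠ 0) (h32 : g z3 z2 ≠ 0) :
    -((z3 / z2 - z2 / z3 - z1 / z3 + z3 / z1) * (g z1 z3 * g z1 z2 / (g z3 z1 * g z2 z1)))
      - (z1 / z2 - z2 / z1 - z3 / z1 + z1 / z3) * (g z1 z3 * g z2 z3 / (g z3 z1 * g z3 z2))
      + (z2 / z1 - z1 / z2 - z3 / z2 + z2 / z3) *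
          (g z1 z2 * g z1 z3 * g z2 z3 / (g z2 z1 * g z3 z1 * g z3 z2))
    = κ * (z2 ^ 2 / (z1 * z3) - 1) * z2 * (z2 + z1) * (z2 + z3) * g z1 z3 /
        (g z2 z1 * g z3 z2) := by
  have hexp : ∀ z w, g z w =
      z ^ 3 - (q1 + q2 + q3) * z ^ 2 * w + (q1 * q2 + q1 * q3 + q2 * q3) * z * w ^ 2 - w ^ 3 := by
    intro z w
    rw [hg]
    linear_combination (-w ^ 3) * hq
  have hκ' : κ = (q1 * q2 + q1 * q3 + q2 * q3) - (q1 + q2 + q3) := by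
    rw [hκ]
    linear_combination -hq
  have key := serre_delta_numerator_identity (q1 + q2 + q3) (q1 * q2 + q1 * q3 + q2 * q3)
    z1 z2 z3 hz1 hz2 hz3
  simp only [← hexp, ← hκ'] at key
  have hclear : ∀ A B C R x12 x13 x23 x21 x31 x32 : ℂ, x21 ≠ 0 → x31 ≠ 0 → x32 ≠ 0 →
      -(A * x12 * x32) - B * x23 * x21 + C * x12 * x23 = R * x31 →
      -(A * (x13 * x12 / (x31 * x21))) - B * (x13 * x23 / (x31 * x32))
        + C * (x12 * x13 * x23 / (x21 * x31 * x32)) = R * x13 / (x21 * x32) := by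
    intro A B C R x12 x13 x23 x21 x31 x32 h21 h31 h32 h
    field_simp
    linear_combination x13 * h
  exact hclear _ _ _ _ _ _ _ _ _ _ h21 h31 h32 key
end

section
/- (Deformed affine Cartan determinant of type A^{(1)}_ℓ.) Let ℓ ≥ 2 be an integer and let s, μ be nonzero complex numbers. Define the (ℓ+1)×(ℓ+1) complex matrix Ĉ = (C_{i,j})_{i,j=0,…,ℓ} by: C_{i,i} = s + s⁻¹ for all 0 ≤ i ≤ ℓ; C_{i,i+1} = C_{i+1,i} = −1 for 1 ≤ i ≤ ℓ−1; C_{0,ℓ} = C_{ℓ,0} = −1; C_{0,1} = −s^{ℓ+1} μ⁻¹; C_{1,0} = −s^{−ℓ−1} μ; all other entries 0. Then det Ĉ = (1 − μ)(s^{−ℓ−1} − μ⁻¹ s^{ℓ+1}). -/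
/-- The weighted cyclic shift matrix, with entry `w i` in position `(i, i + 1)`, indices taken
modulo `n + 1`. -/
def weightedShift {R : Type*} [Zero R] {n : ℕ} (w : Fin (n + 1) → R) :
    Matrix (Fin (n + 1)) (Fin (n + 1)) R :=
  Matrix.of fun i j => if j = i + 1 then w i else 0

theorem det_smul_one_sub_weightedShift {R : Type*} [CommRing R] {n : ℕ} (a : R)
    (w : Fin (n + 1) → R) :
    (a • (1 : Matrix (Fin (n + 1)) (Fin (n + 1)) R) - weightedShift w).det =
      a ^ (n + 1) - ∏ i, w i := by
  rcases n with _ | m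
  · simp [weightedShift, Subsingleton.elim (1 : Fin 1) 0]
  set M := a • (1 : Matrix (Fin (m + 2)) (Fin (m + 2)) R) - weightedShift w with hM
  have entry (i j : Fin (m + 2)) : M i j =
      (if i = j then a else 0) - if j = i + 1 then w i else 0 := by
    simp [hM, weightedShift, Matrix.one_apply]
  have upper : (M.submatrix Fin.succ Fin.succ).det = a ^ (m + 1) := by
    rw [Matrix.det_of_isUpperTriangular]
    · simp [entry]
    · intro i j hij
      have hij : j < i := hij
      simp only [Matrix.submatrix_apply, entry, Fin.ext_iff, Fin.val_add_one, Fin.val_succ,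
        Fin.val_last]
      grind
  have lower : (M.submatrix Fin.castSucc Fin.succ).det = ∏ i : Fin (m + 1), -w i.castSucc := by
    rw [Matrix.det_of_isLowerTriangular]
    · refine Finset.prod_congr rfl fun i _ => ?_
      simp [entry, Fin.ext_iff]
    · intro i j hij
      have hij : i < j := hij
      simp only [Matrix.submatrix_apply, entry, Fin.ext_iff, Fin.val_add_one, Fin.val_succ,
        Fin.val_last, Fin.val_castSucc]
      grind
  have middle (i : Fin m) : M i.castSucc.succ 0 = 0 := by
    simp only [entry, Fin.ext_iff, Fin.val_add_one, Fin.val_succ, Fin.val_last,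
      Fin.val_castSucc, Fin.val_zero]
    grind
  have first : M 0 0 = a := by simp [entry]
  have last : M (Fin.last (m + 1)) 0 = -w (Fin.last (m + 1)) := by
    simp [entry, Fin.ext_iff]
  rw [Matrix.det_succ_column_zero, Fin.sum_univ_succ, Fin.sum_univ_castSucc]
  simp only [middle, Fin.succ_last, Nat.succ_eq_add_one, Fin.succAbove_last, Fin.succAbove_zero,
    first, last, upper, lower, Finset.prod_neg, Finset.card_univ, Fintype.card_fin]
  rw [Fin.prod_univ_castSucc w]
  have sign : ((-1 : R) ^ (m + 1)) * (-1) ^ (m + 1) = 1 := by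
    rw [← mul_pow]; simp
  simp only [Fin.val_zero, Fin.val_last, mul_zero, zero_mul, Finset.sum_const_zero]
  linear_combination (-w (Fin.last (m + 1)) * ∏ i : Fin (m + 1), w i.castSucc) * sign

theorem weightedShift_inv_transpose_mul {K : Type*} [Field K] {n : ℕ} (w : Fin (n + 1) → K)
    (hw : ∀ i, w i ≠ 0) :
    (weightedShift w⁻¹).transpose * weightedShift w = 1 := by
  ext i j
  rw [Matrix.mul_apply, Finset.sum_eq_single (i - 1)]
  · simp [weightedShift, Matrix.one_apply, hw, eq_comm]
  · intro k _ hk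
    have : i ≠ k + 1 := fun h => hk (by simp [h])
    simp [weightedShift, this]
  · simp

/-- determinant of the deformed affine Cartan matrix of type A^{(1)}_ℓ. -/
theorem det_deformed_cartan_A1
    (ℓ : ℕ) (hℓ : 2 ≤ ℓ) (s μ : ℂ) (hs : s ≠ 0) (hμ : μ ≠ 0)
    (C : Matrix (Fin (ℓ + 1)) (Fin (ℓ + 1)) ℂ)
    (hC : ∀ i j : Fin (ℓ + 1), C i j =
      if i = j then s + s⁻¹
      else if i.val = 0 ∧ j.val = 1 then -s ^ (ℓ + 1) * μ⁻¹
      else if i.val = 1 ∧ j.val = 0 then -(s ^ (ℓ + 1))⁻¹ * μ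
      else if i.val + 1 = j.val ∨ j.val + 1 = i.val then -1
      else if (i.val = 0 ∧ j.val = ℓ) ∨ (i.val = ℓ ∧ j.val = 0) then -1
      else 0) :
    C.det = (1 - μ) * ((s ^ (ℓ + 1))⁻¹ - μ⁻¹ * s ^ (ℓ + 1)) := by
  set q := s ^ (ℓ + 1) with hq
  have hq0 : q ≠ 0 := pow_ne_zero _ hs
  set w : Fin (ℓ + 1) → ℂ := fun i => if i = 0 then q * μ⁻¹ else 1 with hw
  have hw0 (i : Fin (ℓ + 1)) : w i ≠ 0 := by
    simp only [hw]; split_ifs <;> simp [hq0, hμ]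
  have prod_w : ∏ i, w i = q * μ⁻¹ := by simp [hw]
  have prod_inv : ∏ i, (s • w⁻¹) i = μ := by
    simp only [Pi.smul_apply, Pi.inv_apply, smul_eq_mul, Finset.prod_mul_distrib,
      Finset.prod_inv_distrib, prod_w, Finset.prod_const, Finset.card_univ, Fintype.card_fin, ← hq]
    field_simp
  have factor : C = ((1 : ℂ) • 1 - weightedShift (s • w⁻¹)).transpose *
      (s⁻¹ • 1 - weightedShift w) := by
    have smul_shift : weightedShift (s • w⁻¹) = s • weightedShift w⁻¹ := by
      ext i j; simp [weightedShift]
    have expand : ((1 : ℂ) • 1 - weightedShift (s • w⁻¹)).transpose *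
        (s⁻¹ • 1 - weightedShift w) =
        (s + s⁻¹) • 1 - weightedShift w - (weightedShift w⁻¹).transpose := by
      rw [smul_shift, Matrix.transpose_sub, Matrix.transpose_smul, Matrix.transpose_smul,
        Matrix.transpose_one, sub_mul, mul_sub, mul_sub]
      simp only [Matrix.smul_mul, Matrix.mul_smul, one_smul, Matrix.one_mul, Matrix.mul_one,
        weightedShift_inv_transpose_mul w hw0, smul_smul, inv_mul_cancel₀ hs]
      module
    rw [expand]
    ext i j
    have hi := i.isLt
    have hj := j.isLt
    simp only [hC, hw, weightedShift, Matrix.sub_apply, Matrix.smul_apply, Matrix.one_apply,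
      Matrix.transpose_apply, Matrix.of_apply, Pi.inv_apply, Fin.ext_iff, Fin.val_add_one,
      Fin.val_last, Fin.val_zero, smul_eq_mul]
    split_ifs <;> first | omega | simp [mul_comm]
  rw [factor, Matrix.det_mul, Matrix.det_transpose, det_smul_one_sub_weightedShift,
    det_smul_one_sub_weightedShift, prod_w, prod_inv, one_pow, inv_pow, mul_comm q]
end

section
/- (Deformed affine Cartan determinant of type B^{(1)}_ℓ.) Let ℓ ≥ 3 be an integer and let s, σ be nonzero complex numbers. Define the (ℓ+1)×(ℓ+1) complex matrix Ĉ = (C_{i,j})_{i,j=0,…,ℓ} by: C_{i,i} = s + s⁻¹ for 0 ≤ i ≤ ℓ−1; C_{ℓ,ℓ} = s σ + s⁻¹ σ⁻¹; C_{0,1} = C_{1,0} = 0; C_{0,2} = C_{2,0} = −1; C_{i,i+1} = C_{i+1,i} = −1 for 1 ≤ i ≤ ℓ−2; C_{ℓ−1,ℓ} = −1; C_{ℓ,ℓ−1} = −(σ + σ⁻¹); all other entries 0. Then det Ĉ = (s² − s^{−2})(s^{ℓ−1} σ − s^{−ℓ+1} σ⁻¹). -/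
open Matrix in
/-- Expansion of a determinant whose first row and first column vanish from the third entry on. -/
theorem Matrix.det_eq_of_first_tridiagonal {R : Type*} [CommRing R] {n : ℕ}
    (M : Matrix (Fin (n + 2)) (Fin (n + 2)) R)
    (hrow : ∀ j : Fin n, M 0 j.succ.succ = 0) (hcol : ∀ i : Fin n, M i.succ.succ 0 = 0) :
    M.det = M 0 0 * (M.submatrix Fin.succ Fin.succ).det
      - M 0 1 * M 1 0 *
        (M.submatrix (fun i : Fin n => i.succ.succ) (fun i : Fin n => i.succ.succ)).det := by
  have hminor : (M.submatrix Fin.succ (Fin.succAbove 1)).det = M 1 0 *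
      (M.submatrix (fun i : Fin n => i.succ.succ) (fun i : Fin n => i.succ.succ)).det := by
    rw [det_succ_column_zero, Fin.sum_univ_succ, Finset.sum_eq_zero]
    · simp [submatrix_submatrix, Function.comp_def]
    · simp [hcol]
  rw [det_succ_row_zero, Fin.sum_univ_succ, Fin.sum_univ_succ, Finset.sum_eq_zero]
  · simp [hminor]
    ring
  · simp [hrow]

open Matrix in
/-- Expansion of a determinant whose first row and first column vanish off the first and third
entries, and in which the second row vanishes from the fourth entry on. -/
theorem Matrix.det_eq_of_first_fork {R : Type*} [CommRing R] {n : ℕ}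
    (M : Matrix (Fin (n + 3)) (Fin (n + 3)) R)
    (hrow₁ : M 0 1 = 0) (hrow : ∀ j : Fin n, M 0 j.succ.succ.succ = 0)
    (hcol₁ : M 1 0 = 0) (hcol : ∀ i : Fin n, M i.succ.succ.succ 0 = 0)
    (hrow' : ∀ j : Fin n, M 1 j.succ.succ.succ = 0) :
    M.det = M 0 0 * (M.submatrix Fin.succ Fin.succ).det
      - M 0 2 * M 2 0 * M 1 1 * (M.submatrix (fun i : Fin n => i.succ.succ.succ)
          (fun i : Fin n => i.succ.succ.succ)).det := by
  have hsucc (i : Fin n) : Fin.succAbove (2 : Fin (n + 3)) i.succ.succ = i.succ.succ.succ := by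
    simp [Fin.succAbove, Fin.lt_def, Fin.val_two, -Fin.coe_ofNat_eq_mod]
  have hsucc' (i : Fin n) : Fin.succAbove (1 : Fin (n + 2)) i.succ = i.succ.succ := by
    simp [Fin.succAbove, Fin.lt_def]
  have hzero : Fin.succAbove (2 : Fin (n + 3)) 0 = 0 := by
    simp [Fin.succAbove, Fin.lt_def, Fin.val_two, -Fin.coe_ofNat_eq_mod]
  have hone : Fin.succAbove (2 : Fin (n + 3)) 1 = 1 := by
    simp [Fin.succAbove, Fin.lt_def, Fin.val_two, -Fin.coe_ofNat_eq_mod]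
  have hminor : (M.submatrix Fin.succ (Fin.succAbove 2)).det = - (M 2 0 * (M 1 1 *
      (M.submatrix (fun i : Fin n => i.succ.succ.succ)
        (fun i : Fin n => i.succ.succ.succ)).det)) := by
    have hminor' : ((M.submatrix Fin.succ (Fin.succAbove 2)).submatrix
        (Fin.succAbove 1) Fin.succ).det = M 1 1 *
        (M.submatrix (fun i : Fin n => i.succ.succ.succ)
          (fun i : Fin n => i.succ.succ.succ)).det := by
      rw [det_succ_row_zero, Fin.sum_univ_succ, Finset.sum_eq_zero]
      · simp [submatrix_submatrix, Function.comp_def, hsucc, hsucc', hone]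
      · simp [hsucc, hrow']
    rw [det_succ_column_zero, Fin.sum_univ_succ, Fin.sum_univ_succ, Finset.sum_eq_zero]
    · simp [← hminor', hcol₁, hzero, submatrix_submatrix]
    · simp [hcol, hzero]
  rw [det_succ_row_zero, Fin.sum_univ_succ, Fin.sum_univ_succ, Fin.sum_univ_succ,
    Finset.sum_eq_zero]
  · simp [hminor, hrow₁, Fin.val_two, -Fin.coe_ofNat_eq_mod]
    ring
  · simp [hrow]

/-- The determinant of the deformed Cartan matrix of finite type `B`. -/
theorem det_deformed_cartan_B {K : Type*} [Field K] {s σ : K} (hs : s ≠ 0) (hσ : σ ≠ 0) (n : ℕ)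
    (M : Matrix (Fin (n + 1)) (Fin (n + 1)) K)
    (hM : ∀ i j, M i j =
      if i.val = j.val then (if i.val = n then s * σ + s⁻¹ * σ⁻¹ else s + s⁻¹)
      else if i.val = n ∧ j.val + 1 = n then -(σ + σ⁻¹)
      else if i.val + 1 = j.val ∨ j.val + 1 = i.val then -1
      else 0) :
    M.det = s ^ (n + 1) * σ + (s ^ (n + 1))⁻¹ * σ⁻¹ := by
  induction n using Nat.twoStepInduction with
  | zero => simp [hM]
  | one =>
    rw [Matrix.det_fin_two]
    simp [hM]
    field_simp
    ring
  | more n ih₀ ih₁ =>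
    rw [Matrix.det_eq_of_first_tridiagonal M (by simp [hM]) (by simp [hM]),
      ih₁ _ (by simp [hM]), ih₀ _ (by simp [hM])]
    simp [hM]
    field_simp
    ring

/-- determinant of the deformed affine Cartan matrix of type B^{(1)}_ℓ. -/
theorem det_deformed_cartan_B1
    (ℓ : ℕ) (hℓ : 3 ≤ ℓ) (s σ : ℂ) (hs : s ≠ 0) (hσ : σ ≠ 0)
    (C : Matrix (Fin (ℓ + 1)) (Fin (ℓ + 1)) ℂ)
    (hC : ∀ i j : Fin (ℓ + 1), C i j =
      if i = j then (if i.val = ℓ then s * σ + s⁻¹ * σ⁻¹ else s + s⁻¹)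
      else if (i.val = 0 ∧ j.val = 2) ∨ (i.val = 2 ∧ j.val = 0) then -1
      else if i.val = ℓ ∧ j.val + 1 = ℓ then -(σ + σ⁻¹)
      else if 1 ≤ i.val ∧ i.val + 1 = j.val then -1
      else if 1 ≤ j.val ∧ j.val + 1 = i.val then -1
      else 0) :
    C.det = (s ^ 2 - (s ^ 2)⁻¹) * (s ^ (ℓ - 1) * σ - (s ^ (ℓ - 1))⁻¹ * σ⁻¹) := by
  obtain ⟨m, rfl⟩ := Nat.exists_eq_add_of_le' hℓ
  have hchain : (C.submatrix Fin.succ Fin.succ).det = _ :=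
    det_deformed_cartan_B hs hσ (m + 2) _ fun i j => by
      simp only [Matrix.submatrix_apply, hC, Fin.ext_iff, Fin.val_succ]
      grind
  have htail : (C.submatrix (fun i : Fin (m + 1) => i.succ.succ.succ)
      (fun i : Fin (m + 1) => i.succ.succ.succ)).det = _ :=
    det_deformed_cartan_B hs hσ m _ fun i j => by
      simp only [Matrix.submatrix_apply, hC, Fin.ext_iff, Fin.val_succ]
      grind
  have h00 : C 0 0 = s + s⁻¹ := by simp [hC]
  have h11 : C 1 1 = s + s⁻¹ := by simp [hC]
  have h02 : C 0 2 = -1 := by simp [hC, Fin.ext_iff, Fin.val_two, -Fin.coe_ofNat_eq_mod]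
  have h20 : C 2 0 = -1 := by simp [hC, Fin.ext_iff, Fin.val_two, -Fin.coe_ofNat_eq_mod]
  have hrow (j : Fin (m + 1)) : C 0 j.succ.succ.succ = 0 := by
    simp only [hC, Fin.ext_iff, Fin.val_succ, Fin.val_zero]
    grind
  have hcol (i : Fin (m + 1)) : C i.succ.succ.succ 0 = 0 := by
    simp only [hC, Fin.ext_iff, Fin.val_succ, Fin.val_zero]
    grind
  have hrow' (j : Fin (m + 1)) : C 1 j.succ.succ.succ = 0 := by
    simp only [hC, Fin.ext_iff, Fin.val_succ, Fin.val_one]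
    grind
  rw [Matrix.det_eq_of_first_fork C (by simp [hC]) hrow (by simp [hC]) hcol hrow',
    hchain, htail, h00, h11, h02, h20]
  simp only [show m + 3 - 1 = m + 2 from rfl]
  field_simp
  ring
end

section
/- (Deformed affine Cartan determinant of type C^{(1)}_ℓ.) Let ℓ ≥ 2 be an integer and let s, r be nonzero complex numbers. Define the (ℓ+1)×(ℓ+1) complex matrix Ĉ = (C_{i,j})_{i,j=0,…,ℓ} by: C_{0,0} = r s⁻¹ + r⁻¹ s; C_{i,i} = s + s⁻¹ for 1 ≤ i ≤ ℓ−1; C_{ℓ,ℓ} = s r⁻¹ + s⁻¹ r; C_{0,1} = −1; C_{1,0} = −(r + r⁻¹); C_{i,i+1} = C_{i+1,i} = −1 for 1 ≤ i ≤ ℓ−2; C_{ℓ−1,ℓ} = −(r + r⁻¹); C_{ℓ,ℓ−1} = −1; all other entries 0. Then det Ĉ = (s − s⁻¹)(s^{ℓ} r^{−2} − s^{−ℓ} r²). -/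
/-- The `n × n` tridiagonal matrix with diagonal `a`, superdiagonal `b` and subdiagonal `c`. -/
def tridiagonal {R : Type*} [Zero R] (a b c : ℕ → R) (n : ℕ) : Matrix (Fin n) (Fin n) R :=
  Matrix.of fun i j =>
    if i.val = j.val then a i
    else if i.val + 1 = j.val then b i
    else if j.val + 1 = i.val then c j
    else 0

/-- The three-term recurrence for the leading principal minors of a tridiagonal matrix. -/
theorem det_tridiagonal_add_two {R : Type*} [CommRing R] (a b c : ℕ → R) (n : ℕ) :
    (tridiagonal a b c (n + 2)).det =
      a (n + 1) * (tridiagonal a b c (n + 1)).det - b n * c n * (tridiagonal a b c n).det := by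
  have hminor : ((tridiagonal a b c (n + 2)).submatrix Fin.castSucc
      (Fin.last n).castSucc.succAbove).det = b n * (tridiagonal a b c n).det := by
    rw [Matrix.det_succ_column _ (Fin.last n), Fin.sum_univ_castSucc, Finset.sum_eq_zero]
    · have hsub : ((tridiagonal a b c (n + 2)).submatrix Fin.castSucc
          (Fin.last n).castSucc.succAbove).submatrix (Fin.last n).succAbove
          (Fin.last n).succAbove = tridiagonal a b c n := by
        ext i j
        simp [tridiagonal, Fin.succAbove, Fin.lt_def]
      rw [hsub]
      simp [tridiagonal, Fin.succAbove]
    · intro i _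
      have hi : i.val ≠ n + 1 ∧ i.val ≠ n ∧ n + 1 + 1 ≠ i.val := by omega
      simp [tridiagonal, Fin.succAbove, hi]
  have hlast : (tridiagonal a b c (n + 2)).submatrix (Fin.last (n + 1)).succAbove
      (Fin.last (n + 1)).succAbove = tridiagonal a b c (n + 1) := by
    ext i j
    simp [tridiagonal]
  rw [Matrix.det_succ_row _ (Fin.last (n + 1)), Fin.sum_univ_castSucc, Fin.sum_univ_castSucc,
    Finset.sum_eq_zero, hlast, Fin.succAbove_last, hminor]
  · have hsign : (-1 : R) ^ (n + 1 + n) = -1 := Odd.neg_one_pow ⟨n, by ring⟩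
    have hval : tridiagonal a b c (n + 2) (Fin.last (n + 1)) (Fin.last n).castSucc = c n := by
      simp [tridiagonal, show n + 1 + 1 ≠ n by omega]
    have hdiag : tridiagonal a b c (n + 2) (Fin.last (n + 1)) (Fin.last (n + 1)) = a (n + 1) := by
      simp [tridiagonal]
    simp only [hval, hdiag, Fin.val_last, Fin.val_castSucc, hsign,
      Even.neg_one_pow ⟨n + 1, rfl⟩]
    ring
  · intro i _
    have hi : n + 1 ≠ i.val ∧ n + 1 + 1 ≠ i.val ∧ i.val ≠ n := by omega
    simp [tridiagonal, hi]

/-- Leading principal minors of a tridiagonal matrix whose first diagonal and first off-diagonal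
entries are those of the deformed affine Cartan matrix of type `C`. -/
theorem det_tridiagonal_typeC {K : Type*} [Field K] {s r : K} (hs : s ≠ 0) (hr : r ≠ 0)
    {a b c : ℕ → K} (n : ℕ) (ha₀ : a 0 = r * s⁻¹ + r⁻¹ * s)
    (ha : ∀ i, 1 ≤ i → i ≤ n → a i = s + s⁻¹) (hbc₀ : 1 ≤ n → b 0 * c 0 = r + r⁻¹)
    (hbc : ∀ i, 1 ≤ i → i < n → b i * c i = 1) :
    (tridiagonal a b c (n + 1)).det = s ^ (n + 1) * r⁻¹ + (s ^ (n + 1))⁻¹ * r := by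
  induction n using Nat.twoStepInduction with
  | zero =>
    simp [tridiagonal, ha₀]
    ring
  | one =>
    rw [det_tridiagonal_add_two, hbc₀ le_rfl, ha 1 le_rfl le_rfl]
    simp [tridiagonal, ha₀]
    field_simp
    ring
  | more n ih₀ ih₁ =>
    rw [det_tridiagonal_add_two, hbc (n + 1) (by omega) (by omega),
      ha (n + 2) (by omega) le_rfl,
      ih₁ (fun i h h' => ha i h (by omega)) (fun _ => hbc₀ (by omega))
        (fun i h h' => hbc i h (by omega)),
      ih₀ (fun i h h' => ha i h (by omega)) (fun _ => hbc₀ (by omega))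
        (fun i h h' => hbc i h (by omega))]
    field_simp
    ring

/-- determinant of the deformed affine Cartan matrix of type C^{(1)}_ℓ. -/
theorem det_deformed_cartan_C1
    (ℓ : ℕ) (hℓ : 2 ≤ ℓ) (s r : ℂ) (hs : s ≠ 0) (hr : r ≠ 0)
    (C : Matrix (Fin (ℓ + 1)) (Fin (ℓ + 1)) ℂ)
    (hC : ∀ i j : Fin (ℓ + 1), C i j =
      if i = j then
        (if i.val = 0 then r * s⁻¹ + r⁻¹ * s
         else if i.val = ℓ then s * r⁻¹ + s⁻¹ * r
         else s + s⁻¹)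
      else if i.val = 1 ∧ j.val = 0 then -(r + r⁻¹)
      else if i.val + 1 = ℓ ∧ j.val = ℓ then -(r + r⁻¹)
      else if i.val + 1 = j.val ∨ j.val + 1 = i.val then -1
      else 0) :
    C.det = (s - s⁻¹) * (s ^ ℓ * (r ^ 2)⁻¹ - (s ^ ℓ)⁻¹ * r ^ 2) := by
  obtain ⟨m, rfl⟩ : ∃ m, ℓ = m + 2 := ⟨ℓ - 2, by omega⟩
  let a : ℕ → ℂ := fun i => if i = 0 then r * s⁻¹ + r⁻¹ * s
    else if i = m + 2 then s * r⁻¹ + s⁻¹ * r else s + s⁻¹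
  let b : ℕ → ℂ := fun i => if i = m + 1 then -(r + r⁻¹) else -1
  let c : ℕ → ℂ := fun i => if i = 0 then -(r + r⁻¹) else -1
  have hCT : C = tridiagonal a b c (m + 2 + 1) := by
    ext i j
    rw [hC]
    simp only [tridiagonal, Matrix.of_apply, a, b, c, Fin.ext_iff]
    split_ifs <;> first | rfl | omega
  have hminor (n : ℕ) (hn : n ≤ m + 1) :
      (tridiagonal a b c (n + 1)).det = s ^ (n + 1) * r⁻¹ + (s ^ (n + 1))⁻¹ * r := by
    refine det_tridiagonal_typeC hs hr n (by simp [a]) (fun i h h' => ?_) (fun _ => ?_)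
      (fun i h h' => ?_)
    · simp [a, show i ≠ 0 by omega, show i ≠ m + 2 by omega]
    · simp [b, c]
    · simp [b, c, show i ≠ 0 by omega, show i ≠ m + 1 by omega]
  have ha : a (m + 2) = s * r⁻¹ + s⁻¹ * r := by simp [a]
  have hbc : b (m + 1) * c (m + 1) = r + r⁻¹ := by simp [b, c]
  rw [hCT, det_tridiagonal_add_two, ha, hbc, hminor (m + 1) le_rfl, hminor m (by omega)]
  field_simp
  ring
end

section
/- (Deformed affine Cartan determinant of type D^{(1)}_ℓ.) Let ℓ ≥ 4 be an integer and let s be a nonzero complex number. Define the (ℓ+1)×(ℓ+1) complex matrix Ĉ = (C_{i,j})_{i,j=0,…,ℓ} by: C_{i,i} = s + s⁻¹ for all 0 ≤ i ≤ ℓ; C_{0,1} = C_{1,0} = 0; C_{0,2} = C_{2,0} = −1; C_{ℓ,ℓ−1} = C_{ℓ−1,ℓ} = 0; C_{ℓ,ℓ−2} = C_{ℓ−2,ℓ} = −1; C_{i,i+1} = C_{i+1,i} = −1 for 1 ≤ i ≤ ℓ−2; all other entries 0. Then det Ĉ = (s + s⁻¹)(s² − s^{−2})(s^{ℓ−2}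 − s^{−ℓ+2}). -/
/-- Expansion of a determinant along a pendant index: row and column `0` are supported on
`{0, p.succ}`. -/
theorem Matrix.det_eq_of_pendant {R : Type*} [CommRing R] {n : ℕ}
    (A : Matrix (Fin (n + 2)) (Fin (n + 2)) R) (p : Fin (n + 1))
    (hrow : ∀ j, j ≠ p → A 0 j.succ = 0) (hcol : ∀ i, i ≠ p → A i.succ 0 = 0) :
    A.det = A 0 0 * (A.submatrix Fin.succ Fin.succ).det
      - A 0 p.succ * A p.succ 0 *
        (A.submatrix (fun i => (p.succAbove i).succ) (fun j => (p.succAbove j).succ)).det := by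
  have hminor : (A.submatrix Fin.succ p.succ.succAbove).det = (-1) ^ (p : ℕ) * A p.succ 0 *
      (A.submatrix (fun i => (p.succAbove i).succ) (fun j => (p.succAbove j).succ)).det := by
    rw [Matrix.det_succ_column_zero, Finset.sum_eq_single p]
    · simp only [Matrix.submatrix_apply, Matrix.submatrix_submatrix, Fin.succ_succAbove_zero]
      congr 3
      ext i
      simp
    · intro i _ hi
      simp [hcol i hi]
    · simp
  rw [Matrix.det_succ_row_zero, Fin.sum_univ_succ, Finset.sum_eq_single p]
  · rw [hminor, Fin.val_succ, pow_succ, Fin.succAbove_zero]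
    have hsign : ((-1 : R) ^ (p : ℕ)) * (-1) ^ (p : ℕ) = 1 := by
      rw [← mul_pow]; simp
    simp only [Fin.val_zero, pow_zero, one_mul]
    linear_combination (-(A 0 p.succ * A p.succ 0 *
      (A.submatrix (fun i => (p.succAbove i).succ) (fun j => (p.succAbove j).succ)).det)) * hsign
  · intro j _ hj
    simp [hrow j hj]
  · simp

/-- The deformed Cartan matrix of type `D_n`, with `x` on the diagonal and the fork at the last
two indices. -/
def forkMatrix {R : Type*} [CommRing R] (x : R) (n : ℕ) : Matrix (Fin n) (Fin n) R :=
  Matrix.of fun i j =>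
    if i.val = j.val then x
    else if (i.val + 1 = j.val ∧ j.val + 1 < n) ∨ (j.val + 1 = i.val ∧ i.val + 1 < n)
      ∨ (i.val + 3 = n ∧ j.val + 1 = n) ∨ (j.val + 3 = n ∧ i.val + 1 = n) then -1
    else 0

theorem det_forkMatrix_two {R : Type*} [CommRing R] (x : R) : (forkMatrix x 2).det = x ^ 2 := by
  simp [Matrix.det_fin_two, forkMatrix, pow_two]

theorem det_forkMatrix_three {R : Type*} [CommRing R] (x : R) :
    (forkMatrix x 3).det = x ^ 3 - 2 * x := by
  simp [Matrix.det_fin_three, forkMatrix]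
  ring

theorem det_forkMatrix_add_four {R : Type*} [CommRing R] (x : R) (n : ℕ) :
    (forkMatrix x (n + 4)).det = x * (forkMatrix x (n + 3)).det - (forkMatrix x (n + 2)).det := by
  have h₁ : (forkMatrix x (n + 4)).submatrix Fin.succ Fin.succ = forkMatrix x (n + 3) := by
    ext i j
    simp only [forkMatrix, Matrix.submatrix_apply, Matrix.of_apply, Fin.val_succ]
    grind
  have h₂ : (forkMatrix x (n + 4)).submatrix (fun i => ((0 : Fin (n + 3)).succAbove i).succ)
      (fun j => ((0 : Fin (n + 3)).succAbove j).succ) = forkMatrix x (n + 2) := by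
    ext i j
    simp only [forkMatrix, Matrix.submatrix_apply, Matrix.of_apply, Fin.val_succ,
      Fin.succAbove_zero]
    grind
  rw [Matrix.det_eq_of_pendant _ 0, h₁, h₂]
  · simp [forkMatrix]
  · intro j hj
    simp only [forkMatrix, Matrix.of_apply, Fin.val_succ, Fin.val_zero]
    have := Fin.val_ne_of_ne hj
    grind
  · intro j hj
    simp only [forkMatrix, Matrix.of_apply, Fin.val_succ, Fin.val_zero]
    have := Fin.val_ne_of_ne hj
    grind

theorem det_forkMatrix {K : Type*} [Field K] {s : K} (hs : s ≠ 0) (n : ℕ) :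
    (forkMatrix (s + s⁻¹) (n + 2)).det = (s + s⁻¹) * (s ^ (n + 1) + (s ^ (n + 1))⁻¹) := by
  induction n using Nat.twoStepInduction with
  | zero => rw [det_forkMatrix_two]; ring
  | one =>
    rw [det_forkMatrix_three]
    field_simp
    ring
  | more n ih₀ ih₁ =>
    rw [det_forkMatrix_add_four, ih₀, ih₁]
    field_simp
    ring


/-- determinant of the deformed affine Cartan matrix of type D^{(1)}_ℓ. -/
theorem det_deformed_cartan_D1
    (ℓ : ℕ) (hℓ : 4 ≤ ℓ) (s : ℂ) (hs : s ≠ 0)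
    (C : Matrix (Fin (ℓ + 1)) (Fin (ℓ + 1)) ℂ)
    (hC : ∀ i j : Fin (ℓ + 1), C i j =
      if i = j then s + s⁻¹
      else if (i.val = 0 ∧ j.val = 2) ∨ (i.val = 2 ∧ j.val = 0)
            ∨ (i.val = ℓ ∧ j.val + 2 = ℓ) ∨ (i.val + 2 = ℓ ∧ j.val = ℓ) then -1
      else if (1 ≤ i.val ∧ i.val + 1 = j.val ∧ j.val < ℓ)
            ∨ (1 ≤ j.val ∧ j.val + 1 = i.val ∧ i.val < ℓ) then -1
      else 0) :
    C.det = (s + s⁻¹) * (s ^ 2 - (s ^ 2)⁻¹) * (s ^ (ℓ - 2) - (s ^ (ℓ - 2))⁻¹) := by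
  obtain ⟨m, rfl⟩ := Nat.exists_eq_add_of_le' hℓ
  have h₁ : C.submatrix Fin.succ Fin.succ = forkMatrix (s + s⁻¹) (m + 4) := by
    ext i j
    simp only [forkMatrix, Matrix.submatrix_apply, Matrix.of_apply, hC, Fin.val_succ, Fin.ext_iff]
    grind
  have hval (i : Fin (m + 3)) :
      ((1 : Fin (m + 4)).succAbove i).val = if i.val = 0 then 0 else i.val + 1 := by
    rcases Fin.eq_zero_or_eq_succ i with rfl | ⟨k, rfl⟩
    · simp
    · simp [Fin.succAbove, Fin.lt_def]
  have h₂ : (C.submatrix (fun i => ((1 : Fin (m + 4)).succAbove i).succ)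
      (fun j => ((1 : Fin (m + 4)).succAbove j).succ)).det
        = (s + s⁻¹) * (forkMatrix (s + s⁻¹) (m + 2)).det := by
    have h₃ : (C.submatrix (fun i => ((1 : Fin (m + 4)).succAbove i).succ)
        (fun j => ((1 : Fin (m + 4)).succAbove j).succ)).submatrix Fin.succ Fin.succ
          = forkMatrix (s + s⁻¹) (m + 2) := by
      ext i j
      simp only [forkMatrix, Matrix.submatrix_apply, Matrix.of_apply, hC, Fin.val_succ,
        Fin.ext_iff, hval]
      grind
    rw [Matrix.det_eq_of_pendant _ 0, h₃]
    · simp only [Matrix.submatrix_apply, hC, Fin.val_succ, Fin.ext_iff, hval, Fin.val_zero]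
      simp
    · intro j hj
      simp only [Matrix.submatrix_apply, hC, Fin.val_succ, Fin.ext_iff, hval, Fin.val_zero]
      grind
    · intro j hj
      simp only [Matrix.submatrix_apply, hC, Fin.val_succ, Fin.ext_iff, hval, Fin.val_zero]
      grind
  rw [Matrix.det_eq_of_pendant C 1, h₁, h₂, det_forkMatrix hs, det_forkMatrix hs]
  · simp only [hC, Fin.ext_iff, Fin.val_succ, Fin.val_zero, Fin.val_one]
    simp
    field_simp
    ring
  · intro j hj
    have := Fin.val_ne_of_ne hj
    simp only [hC, Fin.val_succ, Fin.ext_iff, Fin.val_zero, Fin.val_one] at this ⊢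
    grind
  · intro j hj
    have := Fin.val_ne_of_ne hj
    simp only [hC, Fin.val_succ, Fin.ext_iff, Fin.val_zero, Fin.val_one] at this ⊢
    grind
end

section
/- (Deformed affine Cartan determinant of type A^{(2)}_{2ℓ−1}.) Let ℓ ≥ 3 be an integer and let s, r be nonzero complex numbers. Define the (ℓ+1)×(ℓ+1) complex matrix Ĉ = (C_{i,j})_{i,j=0,…,ℓ} by: C_{i,i} = s + s⁻¹ for 0 ≤ i ≤ ℓ−1; C_{ℓ,ℓ} = s r⁻¹ + s⁻¹ r; C_{0,1} = C_{1,0} = 0; C_{0,2} = C_{2,0} = −1; C_{i,i+1} = C_{i+1,i} = −1 for 1 ≤ i ≤ ℓ−2; C_{ℓ−1,ℓ} = −(r + r⁻¹); C_{ℓ,ℓ−1} = −1; all other entries 0. Then det Ĉ = (s² − s^{−2})(s^{ℓ−1} r⁻¹ − s^{−ℓ+1} r). -/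
namespace Matrix

/-- Expansion of a determinant whose first row and first column vanish beyond their first
two entries. -/
theorem det_eq_of_leaf {R : Type*} [CommRing R] {n : ℕ} (M : Matrix (Fin (n + 2)) (Fin (n + 2)) R)
    (hrow : ∀ j : Fin n, M 0 j.succ.succ = 0) (hcol : ∀ i : Fin n, M i.succ.succ 0 = 0) :
    M.det = M 0 0 * (M.submatrix Fin.succ Fin.succ).det -
      M 0 1 * M 1 0 * (M.submatrix (fun i : Fin n => i.succ.succ) fun j => j.succ.succ).det := by
  have hminor : (M.submatrix Fin.succ (Fin.succAbove 1)).det =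
      M 1 0 * (M.submatrix (fun i : Fin n => i.succ.succ) fun j => j.succ.succ).det := by
    rw [det_succ_column_zero, Fin.sum_univ_succ]
    simp only [submatrix_apply, submatrix_submatrix]
    have hz : (Fin.succAbove (1 : Fin (n + 2)) (0 : Fin (n + 1))) = 0 := by
      simp
    have hs : ((Fin.succAbove (1 : Fin (n + 2))) ∘ Fin.succ) = fun j : Fin n => j.succ.succ := by
      funext j
      rw [Function.comp_apply, ← Fin.succ_zero_eq_one, Fin.succ_succAbove_succ,
        Fin.succAbove_zero]
    simp [hz, hs, hcol, Function.comp_def]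
  rw [det_succ_row_zero, Fin.sum_univ_succ, Fin.sum_univ_succ]
  simp only [hrow, Fin.succ_zero_eq_one, hminor]
  simp
  ring

/-- The tridiagonal determinant attached to the chain ending at the exceptional node. -/
theorem det_chain_cartan {K : Type*} [Field K] (s r : K) (hs : s ≠ 0) (hr : r ≠ 0) (n : ℕ)
    (M : Matrix (Fin (n + 1)) (Fin (n + 1)) K)
    (hM : ∀ i j : Fin (n + 1), M i j =
      if i.val = j.val then (if i.val = n then s * r⁻¹ + s⁻¹ * r else s + s⁻¹)
      else if i.val + 1 = n ∧ j.val = n then -(r + r⁻¹)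
      else if i.val + 1 = j.val ∨ j.val + 1 = i.val then -1
      else 0) :
    M.det = s ^ (n + 1) * r⁻¹ + (s ^ (n + 1))⁻¹ * r := by
  induction n using Nat.twoStepInduction with
  | zero => simp [hM]
  | one =>
    rw [det_fin_two]
    simp [hM]
    field_simp
    ring
  | more n ih₀ ih₁ =>
    rw [det_eq_of_leaf M (by intro j; simp [hM]) (by intro i; simp [hM]), ih₁, ih₀]
    · simp [hM]
      field_simp
      ring
    · intro i j
      simp [hM]
    · intro i j
      simp [hM]

end Matrix

/-- determinant of the deformed affine Cartan matrix of type A^{(2)}_{2ℓ−1}. -/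
theorem det_deformed_cartan_A2odd
    (ℓ : ℕ) (hℓ : 3 ≤ ℓ) (s r : ℂ) (hs : s ≠ 0) (hr : r ≠ 0)
    (C : Matrix (Fin (ℓ + 1)) (Fin (ℓ + 1)) ℂ)
    (hC : ∀ i j : Fin (ℓ + 1), C i j =
      if i = j then (if i.val = ℓ then s * r⁻¹ + s⁻¹ * r else s + s⁻¹)
      else if (i.val = 0 ∧ j.val = 2) ∨ (i.val = 2 ∧ j.val = 0) then -1
      else if i.val + 1 = ℓ ∧ j.val = ℓ then -(r + r⁻¹)
      else if 1 ≤ i.val ∧ i.val + 1 = j.val then -1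
      else if 1 ≤ j.val ∧ j.val + 1 = i.val then -1
      else 0) :
    C.det = (s ^ 2 - (s ^ 2)⁻¹) * (s ^ (ℓ - 1) * r⁻¹ - (s ^ (ℓ - 1))⁻¹ * r) := by
  obtain ⟨n, rfl⟩ := Nat.exists_eq_add_of_le' hℓ
  set A := C.updateRow 0 (C 0 + (-1 : ℂ) • C 1) with hA
  set B := A.updateCol 1 (fun k => A k 1 + (1 : ℂ) • A k 0) with hB
  set D := B.submatrix Fin.succ Fin.succ with hD
  have hdet : C.det = B.det := by
    rw [hB, Matrix.det_updateCol_add_smul_self _ (by simp), hA,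
      Matrix.det_updateRow_add_smul_self _ (by simp)]
  have hB₀ : B 0 0 = s + s⁻¹ := by
    simp only [hB, hA, hC, Matrix.updateCol_apply, Matrix.updateRow_apply, Fin.ext_iff,
      Pi.add_apply, Pi.smul_apply, Fin.val_zero, Fin.val_one, smul_eq_mul]
    grind
  have hB₀' : ∀ j : Fin (n + 3), B 0 j.succ = 0 := by
    intro j
    simp only [hB, hA, hC, Matrix.updateCol_apply, Matrix.updateRow_apply, Fin.ext_iff,
      Pi.add_apply, Pi.smul_apply, Fin.val_succ, Fin.val_zero, Fin.val_one, smul_eq_mul]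
    grind
  have hD_apply : ∀ i j : Fin (n + 3), D i j =
      if i.val = j.val then (if i.val = n + 2 then s * r⁻¹ + s⁻¹ * r else s + s⁻¹)
      else if i.val = 1 ∧ j.val = 0 then -2
      else if i.val + 1 = n + 2 ∧ j.val = n + 2 then -(r + r⁻¹)
      else if i.val + 1 = j.val ∨ j.val + 1 = i.val then -1
      else 0 := by
    intro i j
    simp only [hD, hB, hA, hC, Matrix.submatrix_apply, Matrix.updateCol_apply,
      Matrix.updateRow_apply, Fin.ext_iff, Pi.add_apply, Pi.smul_apply, Fin.val_succ,
      Fin.val_zero, Fin.val_one, smul_eq_mul]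
    grind
  have hexpand : B.det = (s + s⁻¹) * D.det := by
    rw [Matrix.det_succ_row_zero, Fin.sum_univ_succ]
    simp [hB₀, hB₀', hD]
  rw [hdet, hexpand, Matrix.det_eq_of_leaf D (by intro j; simp [hD_apply])
      (by intro i; simp [hD_apply]),
    Matrix.det_chain_cartan s r hs hr (n + 1), Matrix.det_chain_cartan s r hs hr n]
  · simp [hD_apply]
    field_simp
    ring
  · intro i j
    simp [hD_apply]
  · intro i j
    simp [hD_apply]
end
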